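/- arXiv:1206.3347 — 2 statements merged into one kernel-verified Lean document; each statement's English description precedes it below -/
import Mathlib

section
/- Let U ⊆ ℝⁿ be open and connected, k ∈ ℕ, and let (f_j)_{j∈ℕ} and (g_j)_{j∈ℕ} be sequences of functions of class C^k on U such that: for each multi-index α with |α| ≤ k both families (∂^α f_j)_j and (∂^α g_j)_j are pointwise equicontinuous on U; there exist a compact B ⊆ U, c > 0 and points x_{j,α} ∈ B with |∂^α f_j(x_{j,α}) − ∂^α g_j(x_{j,α})| < c for all j ∈ ℕ and all |α| ≤ k; and f_j(x) − g_j(x) → 0 as j → ∞ for every x ∈ U. Then for every x ∈ U and every multi-index α with |α| ≤ k, ∂^α f_j(x) − ∂^α g_j(x) → 0 as j → ∞. -/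
open Filter Topology

noncomputable section

/-- Nonstandard extension of a type, via the hyperfilter ultrapower. -/
abbrev NS (E : Type*) : Type _ := Filter.Germ (Filter.hyperfilter ℕ : Filter ℕ) E

/-- Euclidean `n`-space. -/
abbrev Euc (n : ℕ) : Type := EuclideanSpace ℝ (Fin n)

/-- The hyperreal norm of a nonstandard point. -/
def germNorm {E : Type*} [NormedAddCommGroup E] (ξ : NS E) : Hyperreal :=
  ξ.map norm

/-- The star of a standard real-valued function, applied at a nonstandard point. -/
def starApp {E : Type*} (f : E → ℝ) (ξ : NS E) : Hyperreal := ξ.map f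

/-- The star of a standard map between spaces. -/
def starMap {E F : Type*} (f : E → F) (ξ : NS E) : NS F := ξ.map f

/-- The star of a standard point. -/
def starPt {E : Type*} (x : E) : NS E := ↑(fun _ : ℕ => x)

/-- Value of the star of a standard function `m : ℝ → ℝ` at a hyperreal. -/
def starFun (m : ℝ → ℝ) (δ : Hyperreal) : Hyperreal := Filter.Germ.map m δ

/-- `m` is a modulus on the interval `(0, a)`: strictly increasing, strictly positive,
with limit `0` at `0⁺`. -/
def SMOn (m : ℝ → ℝ) (a : ℝ) : Prop :=
  0 < a ∧ StrictMonoOn m (Set.Ioo 0 a) ∧ (∀ t ∈ Set.Ioo 0 a, 0 < m t) ∧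
    Filter.Tendsto m (𝓝[>] (0:ℝ)) (𝓝 0)

/-- The class `SM` of moduli. -/
def SM : Set (ℝ → ℝ) := {m | ∃ a, SMOn m a}

/-- The set `SN_δ` of moduli values at `δ`. -/
def SN (δ : Hyperreal) : Set Hyperreal := {x | ∃ m ∈ SM, starFun m δ = x}

end
noncomputable section
/-- Internal functions on `ℝⁿ`: germs of sequences of functions. -/
abbrev IntFun (n : ℕ) := Filter.Germ (Filter.hyperfilter ℕ : Filter ℕ) (Euc n → ℝ)

/-- Application of an internal function at a nonstandard point (binary germ-lift). -/
def iapp {n : ℕ} (F : IntFun n) (ξ : NS (Euc n)) : Hyperreal :=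
  Filter.Germ.map₂ (fun f x => f x) F ξ

/-- `ξ` is nearstandard in the open set `U`. -/
def NearStd {n : ℕ} (U : Set (Euc n)) (ξ : NS (Euc n)) : Prop :=
  ∃ x ∈ U, (germNorm (ξ - starPt x)).Infinitesimal

/-- Infinitesimal closeness of nonstandard points. -/
def InfClose {n : ℕ} (ξ ζ : NS (Euc n)) : Prop :=
  (germNorm (ξ - ζ)).Infinitesimal

/-- A hyperreal is finite when bounded in absolute value by a standard real. -/
def HFin (x : Hyperreal) : Prop := ∃ r : ℝ, |x| ≤ (r : Hyperreal)

/-- Partial derivative in the `i`-th coordinate direction. -/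
noncomputable def pderivCoord {n : ℕ} (i : Fin n) (f : Euc n → ℝ) : Euc n → ℝ :=
  fun x => fderiv ℝ f x (EuclideanSpace.single i (1 : ℝ))

/-- Iterated partial derivative `∂^α` along the multi-index (list of coordinates) `α`. -/
noncomputable def pderivMulti {n : ℕ} : List (Fin n) → (Euc n → ℝ) → Euc n → ℝ
  | [], f => f
  | i :: L, f => pderivCoord i (pderivMulti L f)

/-- Internal iterated partial derivative `∂^α 𝔉` of an internal function. -/
noncomputable def intDeriv {n : ℕ} (L : List (Fin n)) (F : IntFun n) : IntFun n :=
  F.map (pderivMulti L)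

/-- An internal function is of class `SC^k` on the open set `U`: it is the germ of a
sequence of `C^k` functions on `U` all of whose internal derivatives of order `≤ k` are
finite at nearstandard points of `U` and S-continuous there. -/
def SCk {n : ℕ} (k : ℕ) (U : Set (Euc n)) (F : IntFun n) : Prop :=
  ∃ Fs : ℕ → Euc n → ℝ, F = ↑Fs ∧ (∀ i : ℕ, ContDiffOn ℝ k (Fs i) U) ∧
    ∀ L : List (Fin n), L.length ≤ k →
      (∀ ξ : NS (Euc n), NearStd U ξ → HFin (iapp (intDeriv L F) ξ)) ∧
      (∀ ξ ζ : NS (Euc n), NearStd U ξ → NearStd U ζ → InfClose ξ ζ →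
        (iapp (intDeriv L F) ξ - iapp (intDeriv L F) ζ).Infinitesimal)

/-- The standard part of an internal function: `°𝔉(x) = st(𝔉(*x))`. -/
noncomputable def stdPart {n : ℕ} (F : IntFun n) : Euc n → ℝ :=
  fun x => (iapp F (starPt x)).st
end

theorem contDiffOn_pderivMulti {n : ℕ} {U : Set (Euc n)} (hU : IsOpen U) {f : Euc n → ℝ}
    (L : List (Fin n)) (m : ℕ) (hf : ContDiffOn ℝ ((m + L.length : ℕ) : WithTop ℕ∞) f U) :
    ContDiffOn ℝ m (pderivMulti L f) U := by
  induction L generalizing m with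
  | nil => exact hf
  | cons i L ih =>
    have h : ContDiffOn ℝ ((m + 1 : ℕ) : WithTop ℕ∞) (pderivMulti L f) U :=
      ih (m + 1) (by rwa [Nat.add_right_comm, Nat.add_assoc])
    exact (h.fderiv_of_isOpen hU (by push_cast; exact le_rfl)).clm_apply contDiffOn_const

theorem ContDiffOn.differentiableAt_pderivMulti {n k : ℕ} {U : Set (Euc n)} (hU : IsOpen U)
    {f : Euc n → ℝ} (hf : ContDiffOn ℝ k f U) {L : List (Fin n)} (hL : L.length < k)
    {x : Euc n} (hx : x ∈ U) : DifferentiableAt ℝ (pderivMulti L f) x := by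
  have h := contDiffOn_pderivMulti hU L 1
    (hf.of_le (by exact_mod_cast (by omega : 1 + L.length ≤ k)))
  exact (h.differentiableOn (by simp)).differentiableAt (hU.mem_nhds hx)

/-- The mean value theorem along the ray from `x` in the direction `e`. -/
theorem exists_fderiv_apply_eq_slope {E : Type*} [NormedAddCommGroup E] [NormedSpace ℝ E]
    {w : E → ℝ} {x e : E} {t : ℝ} (ht : 0 < t)
    (hw : ∀ s ∈ Set.Icc 0 t, DifferentiableAt ℝ w (x + s • e)) :
    ∃ s ∈ Set.Ioo 0 t, fderiv ℝ w (x + s • e) e = (w (x + t • e) - w x) / t := by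
  have hd : ∀ s ∈ Set.Icc 0 t,
      HasDerivAt (fun s : ℝ => w (x + s • e)) (fderiv ℝ w (x + s • e) e) s := by
    intro s hs
    have h : HasDerivAt (fun s : ℝ => x + s • e) e s := by
      simpa using ((hasDerivAt_id s).smul_const e).const_add x
    exact (hw s hs).hasFDerivAt.comp_hasDerivAt s h
  obtain ⟨s, hs, h⟩ := exists_hasDerivAt_eq_slope (fun s : ℝ => w (x + s • e)) _ ht
    (fun s hs => (hd s hs).continuousAt.continuousWithinAt)
    (fun s hs => hd s (Set.Ioo_subset_Icc_self hs))
  exact ⟨s, hs, by simpa using h⟩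

/-- If differentiable functions `u j - v j` tend to `0` pointwise and the directional derivatives
of `u j` and of `v j` are equicontinuous at `x`, then the directional derivatives of `u j - v j`
tend to `0` at `x`. -/
theorem tendsto_fderiv_apply_sub_of_equicontinuous {E : Type*} [NormedAddCommGroup E]
    [NormedSpace ℝ E] {U : Set E} (hU : IsOpen U) {u v : ℕ → E → ℝ} {x e : E} (hx : x ∈ U)
    (hu : ∀ j, ∀ y ∈ U, DifferentiableAt ℝ (u j) y)
    (hv : ∀ j, ∀ y ∈ U, DifferentiableAt ℝ (v j) y)
    (hequiu : ∀ ε : ℝ, 0 < ε → ∃ ρ : ℝ, 0 < ρ ∧ ∀ j, ∀ y ∈ U, ‖y - x‖ < ρ →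
      |fderiv ℝ (u j) y e - fderiv ℝ (u j) x e| < ε)
    (hequiv : ∀ ε : ℝ, 0 < ε → ∃ ρ : ℝ, 0 < ρ ∧ ∀ j, ∀ y ∈ U, ‖y - x‖ < ρ →
      |fderiv ℝ (v j) y e - fderiv ℝ (v j) x e| < ε)
    (hconv : ∀ y ∈ U, Tendsto (fun j => u j y - v j y) atTop (𝓝 0)) :
    Tendsto (fun j => fderiv ℝ (u j) x e - fderiv ℝ (v j) x e) atTop (𝓝 0) := by
  rw [Metric.tendsto_nhds]
  intro ε hε
  obtain ⟨ρ₁, hρ₁, h₁⟩ := hequiu (ε / 3) (by positivity)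
  obtain ⟨ρ₂, hρ₂, h₂⟩ := hequiv (ε / 3) (by positivity)
  obtain ⟨r, hr, hrU⟩ := Metric.isOpen_iff.1 hU x hx
  set ρ := min r (min ρ₁ ρ₂)
  have hρ : 0 < ρ := by positivity
  set t := ρ / (‖e‖ + 1)
  have ht : 0 < t := by positivity
  have hnorm : ∀ s ∈ Set.Icc 0 t, ‖x + s • e - x‖ < ρ := by
    intro s hs
    rw [add_sub_cancel_left, norm_smul, Real.norm_of_nonneg hs.1]
    calc s * ‖e‖ ≤ t * ‖e‖ := by gcongr; exact hs.2
      _ < t * (‖e‖ + 1) := by gcongr; linarith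
      _ = ρ := div_mul_cancel₀ _ (by positivity)
  have hmem : ∀ s ∈ Set.Icc 0 t, x + s • e ∈ U := fun s hs =>
    hrU (mem_ball_iff_norm.2 ((hnorm s hs).trans_le (min_le_left _ _)))
  have hslope : Tendsto
      (fun j => ((u j (x + t • e) - v j (x + t • e)) - (u j x - v j x)) / t) atTop (𝓝 0) := by
    simpa using ((hconv _ (hmem t ⟨ht.le, le_rfl⟩)).sub (hconv x hx)).div_const t
  filter_upwards [(Metric.tendsto_nhds.1 hslope) (ε / 3) (by positivity)] with j hj
  obtain ⟨s, hs, hsl⟩ := exists_fderiv_apply_eq_slope (w := fun y => u j y - v j y) ht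
    (fun s hs => (hu j _ (hmem s hs)).fun_sub (hv j _ (hmem s hs)))
  have hs' := Set.Ioo_subset_Icc_self hs
  rw [fderiv_fun_sub (hu j _ (hmem s hs')) (hv j _ (hmem s hs')),
    sub_apply] at hsl
  rw [← hsl] at hj
  have hlt := (hnorm s hs').trans_le (min_le_right _ _)
  have hb₁ := h₁ j _ (hmem s hs') (hlt.trans_le (min_le_left _ _))
  have hb₂ := h₂ j _ (hmem s hs') (hlt.trans_le (min_le_right _ _))
  rw [Real.dist_0_eq_abs, abs_lt] at hj ⊢
  rw [abs_lt] at hb₁ hb₂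
  constructor <;> linarith [hj.1, hj.2, hb₁.1, hb₁.2, hb₂.1, hb₂.2]

/-- For two equicontinuous-in-all-derivatives, suitably compatible
sequences of `C^k` functions on a connected open set, pointwise convergence of the
differences to `0` forces pointwise convergence to `0` of all differences of derivatives
of order `≤ k`. -/
theorem stmt16 {n : ℕ} (k : ℕ) (U : Set (Euc n)) (hU : IsOpen U) (hconn : IsConnected U)
    (f g : ℕ → Euc n → ℝ)
    (hf : ∀ j : ℕ, ContDiffOn ℝ k (f j) U) (hg : ∀ j : ℕ, ContDiffOn ℝ k (g j) U)
    (hequif : ∀ α : List (Fin n), α.length ≤ k → ∀ x ∈ U, ∀ ε : ℝ, 0 < ε → ∃ ρ : ℝ, 0 < ρ ∧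
      ∀ j : ℕ, ∀ y ∈ U, ‖y - x‖ < ρ →
        |pderivMulti α (f j) y - pderivMulti α (f j) x| < ε)
    (hequig : ∀ α : List (Fin n), α.length ≤ k → ∀ x ∈ U, ∀ ε : ℝ, 0 < ε → ∃ ρ : ℝ, 0 < ρ ∧
      ∀ j : ℕ, ∀ y ∈ U, ‖y - x‖ < ρ →
        |pderivMulti α (g j) y - pderivMulti α (g j) x| < ε)
    (hbd : ∃ B : Set (Euc n), IsCompact B ∧ B ⊆ U ∧ ∃ c : ℝ, 0 < c ∧
      ∃ x : ℕ → List (Fin n) → Euc n, ∀ j : ℕ, ∀ α : List (Fin n), α.length ≤ k →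
        x j α ∈ B ∧ |pderivMulti α (f j) (x j α) - pderivMulti α (g j) (x j α)| < c)
    (hconv : ∀ x ∈ U, Filter.Tendsto (fun j : ℕ => f j x - g j x) Filter.atTop (𝓝 0)) :
    ∀ x ∈ U, ∀ α : List (Fin n), α.length ≤ k →
      Filter.Tendsto (fun j : ℕ => pderivMulti α (f j) x - pderivMulti α (g j) x)
        Filter.atTop (𝓝 0) := by
  intro x hx α hα
  induction α generalizing x with
  | nil => exact hconv x hx
  | cons i L ih =>
    have hL : L.length < k := by simpa using hα
    exact tendsto_fderiv_apply_sub_of_equicontinuous hU hx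
      (fun j y hy => (hf j).differentiableAt_pderivMulti hU hL hy)
      (fun j y hy => (hg j).differentiableAt_pderivMulti hU hL hy)
      (hequif (i :: L) hα x hx) (hequig (i :: L) hα x hx) (fun y hy => ih y hy hL.le)
end

section
/- Let U ⊆ ℝⁿ be open and connected and let h : ℕ → (ℝⁿ → ℝ) be a sequence of functions, each continuous on U, that is pointwise equicontinuous on U and for which there exist c > 0, a compact B ⊆ U and points x_j ∈ B with |h_j(x_j)| < c for all j ∈ ℕ. Then for every infinite hypernatural ω (i.e., ω ∈ Filter.Germ (hyperfilter ℕ) ℕ with ω > *j for every j ∈ ℕ), the internal function 𝔉 := (Germ.map h)(ω) is S-continuous on the nearstandard points of U: 𝔉(ξ) is finite for every ξ nearstandard in U, and 𝔉(ξ) − 𝔉(ζ) is infinitesimal whenever ξ ≈ ζ are nearstandard in U. -/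
open Filter Topology

/-- Pointwise equicontinuity on a preconnected set bounds the differences of values uniformly
in the family. -/
lemma exists_bound_sub_of_isPreconnected {E ι : Type*} [NormedAddCommGroup E] {U : Set E}
    (hconn : IsPreconnected U) {h : ι → E → ℝ}
    (hequi : ∀ x ∈ U, ∀ ε : ℝ, 0 < ε → ∃ ρ : ℝ, 0 < ρ ∧
      ∀ j, ∀ y ∈ U, ‖y - x‖ < ρ → |h j y - h j x| < ε)
    {x y : E} (hx : x ∈ U) (hy : y ∈ U) : ∃ M : ℝ, ∀ j, |h j x - h j y| ≤ M := by
  refine hconn.induction₂' (fun x y => ∃ M : ℝ, ∀ j, |h j x - h j y| ≤ M) ?_ ?_ hx hy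
  · intro x hx
    obtain ⟨ρ, hρ, H⟩ := hequi x hx 1 one_pos
    filter_upwards [self_mem_nhdsWithin, mem_nhdsWithin_of_mem_nhds (Metric.ball_mem_nhds x hρ)]
      with y hyU hy
    have hy' := fun j => (H j y hyU (by rwa [← dist_eq_norm])).le
    exact ⟨⟨1, fun j => by rw [abs_sub_comm]; exact hy' j⟩, 1, hy'⟩
  · rintro x y z - - - ⟨M, hM⟩ ⟨N, hN⟩
    exact ⟨M + N, fun j => (abs_sub_le _ _ _).trans (add_le_add (hM j) (hN j))⟩

/-- A pointwise equicontinuous family on a preconnected set is uniformly bounded at every point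
as soon as each member is bounded by `c` somewhere on a fixed compact subset. -/
lemma exists_bound_of_equicontinuous {E ι : Type*} [NormedAddCommGroup E] {U B : Set E}
    (hconn : IsPreconnected U) {h : ι → E → ℝ}
    (hequi : ∀ x ∈ U, ∀ ε : ℝ, 0 < ε → ∃ ρ : ℝ, 0 < ρ ∧
      ∀ j, ∀ y ∈ U, ‖y - x‖ < ρ → |h j y - h j x| < ε)
    (hB : IsCompact B) (hBU : B ⊆ U) {c : ℝ} {b : ι → E}
    (hb : ∀ j, b j ∈ B ∧ |h j (b j)| < c) {x : E} (hx : x ∈ U) :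
    ∃ M : ℝ, ∀ j, |h j x| ≤ M := by
  have key : ∃ M : ℝ, ∀ y ∈ B, ∀ j, |h j x - h j y| ≤ M := by
    refine hB.induction_on (p := fun s => ∃ M : ℝ, ∀ y ∈ s, ∀ j, |h j x - h j y| ≤ M)
      ⟨0, by simp⟩ ?_ ?_ ?_
    · rintro s t hst ⟨M, hM⟩
      exact ⟨M, fun y hy => hM y (hst hy)⟩
    · rintro s t ⟨M, hM⟩ ⟨N, hN⟩
      refine ⟨max M N, ?_⟩
      rintro y (hy | hy) j
      · exact (hM y hy j).trans (le_max_left _ _)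
      · exact (hN y hy j).trans (le_max_right _ _)
    · intro z hz
      obtain ⟨M, hM⟩ := exists_bound_sub_of_isPreconnected hconn hequi hx (hBU hz)
      obtain ⟨ρ, hρ, H⟩ := hequi z (hBU hz) 1 one_pos
      refine ⟨B ∩ Metric.ball z ρ, inter_mem_nhdsWithin _ (Metric.ball_mem_nhds z hρ), M + 1, ?_⟩
      rintro y ⟨hyB, hy⟩ j
      have h1 := H j y (hBU hyB) (by rwa [← dist_eq_norm])
      rw [abs_sub_comm] at h1
      exact (abs_sub_le _ _ _).trans (add_le_add (hM j) h1.le)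
  obtain ⟨M, hM⟩ := key
  refine ⟨M + c, fun j => ?_⟩
  have h1 := hM (b j) (hb j).1 j
  have h2 := abs_sub_abs_le_abs_sub (h j x) (h j (b j))
  linarith [(hb j).2]

/-- Along any choice of indices, a pointwise equicontinuous family is asymptotically constant near
a point of the open set. -/
lemma tendsto_sub_of_equicontinuous {E ι α : Type*} [NormedAddCommGroup E] {U : Set E}
    (hU : IsOpen U) {h : ι → E → ℝ}
    (hequi : ∀ x ∈ U, ∀ ε : ℝ, 0 < ε → ∃ ρ : ℝ, 0 < ρ ∧
      ∀ j, ∀ y ∈ U, ‖y - x‖ < ρ → |h j y - h j x| < ε)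
    {l : Filter α} {u : α → E} {x : E} (hx : x ∈ U) (hu : Tendsto u l (𝓝 x)) (w : α → ι) :
    Tendsto (fun i => h (w i) (u i) - h (w i) x) l (𝓝 0) := by
  rw [Metric.tendsto_nhds]
  intro ε hε
  obtain ⟨ρ, hρ, H⟩ := hequi x hx ε hε
  filter_upwards [hu (hU.mem_nhds hx), hu (Metric.ball_mem_nhds x hρ)] with i hiU hi
  rw [Real.dist_0_eq_abs]
  exact H _ _ hiU (by rwa [← dist_eq_norm])

set_option linter.deprecated false in
/-- The hyperreal represented by a sequence is infinitesimal iff the sequence tends to `0` along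
the hyperfilter. -/
lemma infinitesimal_coe_iff {f : ℕ → ℝ} :
    Hyperreal.Infinitesimal (f : NS ℝ) ↔ Tendsto f (hyperfilter ℕ) (𝓝 0) :=
  Hyperreal.isSt_ofSeq_iff_tendsto

lemma infClose_coe_iff {n : ℕ} {u v : ℕ → Euc n} :
    InfClose (u : NS (Euc n)) (v : NS (Euc n)) ↔
      Tendsto (fun i => ‖u i - v i‖) (hyperfilter ℕ) (𝓝 0) :=
  infinitesimal_coe_iff

lemma nearStd_coe_iff {n : ℕ} {U : Set (Euc n)} {u : ℕ → Euc n} :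
    NearStd U (u : NS (Euc n)) ↔ ∃ x ∈ U, Tendsto u (hyperfilter ℕ) (𝓝 x) :=
  exists_congr fun _ => and_congr_right fun _ =>
    infinitesimal_coe_iff.trans tendsto_iff_norm_sub_tendsto_zero.symm

/-- For a pointwise equicontinuous, suitably bounded sequence of
continuous functions on a connected open set, the internal function obtained by evaluating
the extended sequence at any infinite hypernatural is S-continuous on the nearstandard
points of `U`. -/
theorem stmt18 {n : ℕ} (U : Set (Euc n)) (hU : IsOpen U) (hconn : IsConnected U)
    (h : ℕ → Euc n → ℝ) (hcont : ∀ j : ℕ, ContinuousOn (h j) U)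
    (hequi : ∀ x ∈ U, ∀ ε : ℝ, 0 < ε → ∃ ρ : ℝ, 0 < ρ ∧
      ∀ j : ℕ, ∀ y ∈ U, ‖y - x‖ < ρ → |h j y - h j x| < ε)
    (hbd : ∃ c : ℝ, 0 < c ∧ ∃ B : Set (Euc n), IsCompact B ∧ B ⊆ U ∧
      ∃ x : ℕ → Euc n, ∀ j : ℕ, x j ∈ B ∧ |h j (x j)| < c)
    (ω : NS ℕ) (hω : ∀ j : ℕ, starPt j < ω) :
    (∀ ξ : NS (Euc n), NearStd U ξ → HFin (iapp (Filter.Germ.map h ω) ξ)) ∧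
    (∀ ξ ζ : NS (Euc n), NearStd U ξ → NearStd U ζ → InfClose ξ ζ →
      (iapp (Filter.Germ.map h ω) ξ - iapp (Filter.Germ.map h ω) ζ).Infinitesimal) := by
  obtain ⟨c, -, B, hB, hBU, b, hb⟩ := hbd
  induction ω using Germ.inductionOn with | _ w
  refine ⟨fun ξ => ?_, fun ξ ζ => ?_⟩
  · induction ξ using Germ.inductionOn with | _ u
    rw [nearStd_coe_iff]
    rintro ⟨x, hx, hu⟩
    obtain ⟨M, hM⟩ := exists_bound_of_equicontinuous hconn.isPreconnected hequi hB hBU hb hx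
    have ht := tendsto_sub_of_equicontinuous hU hequi hx hu w
    refine ⟨M + 1, ?_⟩
    have hle : ∀ᶠ i in (hyperfilter ℕ : Filter ℕ), |h (w i) (u i)| ≤ M + 1 := by
      filter_upwards [ht (Metric.ball_mem_nhds 0 one_pos)] with i hi
      rw [Set.mem_preimage, mem_ball_zero_iff, Real.norm_eq_abs] at hi
      have := abs_sub_abs_le_abs_sub (h (w i) (u i)) (h (w i) x)
      linarith [hM (w i)]
    refine le_of_eq_of_le (Germ.abs_def _) ?_
    exact Germ.coe_le.2 hle
  · induction ξ using Germ.inductionOn with | _ u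
    induction ζ using Germ.inductionOn with | _ v
    rw [nearStd_coe_iff, infClose_coe_iff]
    rintro ⟨x, hx, hu⟩ - huv
    have hv : Tendsto v (hyperfilter ℕ) (𝓝 x) := by
      simpa using hu.sub (tendsto_zero_iff_norm_tendsto_zero.2 huv)
    have ht := (tendsto_sub_of_equicontinuous hU hequi hx hu w).sub
      (tendsto_sub_of_equicontinuous hU hequi hx hv w)
    simp only [sub_sub_sub_cancel_right, sub_zero] at ht
    exact infinitesimal_coe_iff.2 ht
end
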